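/- Let λ∈{1,−1}, γ>0, M>0 and ε∈(0,γ). There exists C=C(γ,ε,M)>0 with the following property. Let τ>0 and N≥1 with τN²≤1, let L be a positive integer, t_n=nτ, and u^0,…,u^{L−1}∈L²(𝕋) with ‖u^n‖_{L²(𝕋)}≤M for all n. With Ψ₁(x)=e^x−(1+x+x²/2), define for a function u with Fourier support in |k|≤N: R_n^6[u] = −e^{−it_{n+1}∂_x²}e^{i(τ/2)∂_x²}Π_{≤N}[ Ψ₁(−iλτ|e^{i(τ/2)∂_x²}u|²) · e^{i(τ/2)∂_x²}u ]. Then Σ_{n=0}^{L−1} ‖R_n^6[Π_{≤N}u^n]‖_{L²(𝕋)} ≤ C τ² N Y⁶, where Y = τ^{1/6}(Σ_{n=0}^{L−1}‖J^{γ−ε}Π_{≤N}u^n‖⁶_{L⁶(𝕋)})^{1/6}. -/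

import Mathlib

open MeasureTheory Real Set Filter
open scoped ENNReal

noncomputable section

instance fact2pi : Fact (0 < 2 * π) := ⟨by positivity⟩

abbrev Torus : Type := AddCircle (2 * π)

/-- Fourier multiplier operator with symbol `m`. -/
def mult (m : ℤ → ℂ) (f : Torus → ℂ) : Torus → ℂ :=
  fun x => ∑' k : ℤ, m k * fourierCoeff f k * fourier k x

/-- `J^s`, the Fourier multiplier with symbol `(1+k²)^{s/2}`. -/
def Jop (s : ℝ) : (Torus → ℂ) → (Torus → ℂ) :=
  mult (fun k => (((1 + (k : ℝ) ^ 2) ^ (s / 2) : ℝ) : ℂ))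

/-- `e^{it∂_x²}`, the Fourier multiplier with symbol `e^{itk²}`. -/
def linProp (t : ℝ) : (Torus → ℂ) → (Torus → ℂ) :=
  mult (fun k => Complex.exp (Complex.I * t * (k : ℂ) ^ 2))

/-- The projection `Π_{≤N}` onto frequencies `|k| ≤ N`. -/
def PiLe (N : ℝ) : (Torus → ℂ) → (Torus → ℂ) :=
  mult (fun k => if (|k| : ℝ) ≤ N then 1 else 0)

/-- Complex conjugate of a function. -/
def conjFun (u : Torus → ℂ) : Torus → ℂ := fun y => starRingEnd ℂ (u y)

/-- `|u|² ū`. -/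
def cubicC (u : Torus → ℂ) : Torus → ℂ :=
  fun y => ((‖u y‖ ^ 2 : ℝ) : ℂ) * starRingEnd ℂ (u y)

/-- `|u|² u`. -/
def cubicF (u : Torus → ℂ) : Torus → ℂ := fun y => ((‖u y‖ ^ 2 : ℝ) : ℂ) * u y

/-- The quantity `Y = τ^{1/6} (Σ_{n<L} ‖J^{γ-ε}Π_{≤N}u^n‖⁶_{L⁶})^{1/6}`. -/
def Yquant (γ ε τ N : ℝ) (L : ℕ) (un : ℕ → Torus → ℂ) : ℝ :=
  τ ^ ((1 : ℝ) / 6) *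
    (∑ n ∈ Finset.range L,
        ((eLpNorm (Jop (γ - ε) (PiLe N (un n))) 6 volume).toReal) ^ 6) ^ ((1 : ℝ) / 6)

/-- `Ψ₁(x) = e^x − (1 + x + x²/2)`. -/
def Psi1 (z : ℂ) : ℂ := Complex.exp z - (1 + z + z ^ 2 / 2)

/-- The defect term `R_n^6[u]` (with `tnp1 = t_{n+1}`). -/
def R6 (lam τ N tnp1 : ℝ) (u : Torus → ℂ) : Torus → ℂ := fun x =>
  -(linProp (-tnp1) (linProp (τ / 2) (PiLe N (fun y =>
      Psi1 (-Complex.I * lam * τ * ((‖linProp (τ / 2) u y‖ ^ 2 : ℝ) : ℂ)) *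
        linProp (τ / 2) u y))) x)

open AddCircle

/-- Trigonometric polynomial of degree at most `K`. -/
def TP (K : ℕ) (a : ℤ → ℂ) : Torus → ℂ :=
  fun x => ∑ j ∈ Finset.Icc (-(K : ℤ)) K, a j * fourier j x

lemma TP_cont (K : ℕ) (a : ℤ → ℂ) : Continuous (TP K a) := by
  unfold TP
  fun_prop

lemma TP_congr {K : ℕ} {a b : ℤ → ℂ} (h : ∀ j : ℤ, |j| ≤ K → a j = b j) : TP K a = TP K b := by
  funext x
  refine Finset.sum_congr rfl fun j hj => ?_
  rw [h j (abs_le.2 (Finset.mem_Icc.1 hj))]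

lemma int_haar {f : Torus → ℂ} (hf : Continuous f) : Integrable f haarAddCircle :=
  hf.integrable_of_hasCompactSupport (HasCompactSupport.of_compactSpace f)

lemma int_haarR {f : Torus → ℝ} (hf : Continuous f) : Integrable f haarAddCircle :=
  hf.integrable_of_hasCompactSupport (HasCompactSupport.of_compactSpace f)

lemma fourierCoeff_fourier_eq (j k : ℤ) :
    fourierCoeff (fun x : Torus => (fourier j x : ℂ)) k = if j = k then 1 else 0 := by
  have := congrFun (fourierCoeff_fourier (T := 2 * π) j) k
  rw [this]
  simp [Pi.single_apply, eq_comm]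

lemma TP_coeff (K : ℕ) (a : ℤ → ℂ) (k : ℤ) :
    fourierCoeff (TP K a) k = if |k| ≤ K then a k else 0 := by
  have h1 : TP K a = ∑ j ∈ Finset.Icc (-(K : ℤ)) K, fun x : Torus => a j * fourier j x := by
    funext x; simp [TP]
  rw [h1, fourierCoeff.sum _ _ (fun j _ => int_haar (by fun_prop))]
  rw [Finset.sum_apply]
  simp_rw [fourierCoeff.const_mul, fourierCoeff_fourier_eq]
  simp [abs_le]

lemma mult_TP (m a : ℤ → ℂ) (K : ℕ) : mult m (TP K a) = TP K (fun j => m j * a j) := by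
  funext x
  unfold mult
  rw [tsum_eq_sum (s := Finset.Icc (-(K : ℤ)) K)]
  · refine Finset.sum_congr rfl fun j hj => ?_
    rw [TP_coeff, if_pos (abs_le.2 (Finset.mem_Icc.1 hj))]
  · intro j hj
    rw [TP_coeff, if_neg (fun h => hj (Finset.mem_Icc.2 (abs_le.1 h)))]
    simp

lemma PiLe_eq (N : ℝ) (hN : 1 ≤ N) (f : Torus → ℂ) : PiLe N f = TP ⌊N⌋₊ (fourierCoeff f) := by
  have key : ∀ j : ℤ, ((|j| : ℝ) ≤ N ↔ |j| ≤ (⌊N⌋₊ : ℤ)) := by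
    intro j
    rw [Int.natCast_floor_eq_floor (by linarith), Int.le_floor]
    push_cast
    rfl
  funext x
  unfold PiLe mult
  rw [tsum_eq_sum (s := Finset.Icc (-(⌊N⌋₊ : ℤ)) ⌊N⌋₊)]
  · refine Finset.sum_congr rfl fun j hj => ?_
    beta_reduce
    rw [if_pos ((key j).2 (abs_le.2 (Finset.mem_Icc.1 hj))), one_mul]
  · intro j hj
    beta_reduce
    rw [if_neg (fun h => hj (Finset.mem_Icc.2 (abs_le.1 ((key j).1 h))))]
    simp

lemma parseval {f : Torus → ℂ} (hf : MemLp f 2 (haarAddCircle (T := 2 * π))) :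
    HasSum (fun i => ‖fourierCoeff f i‖ ^ 2) (∫ t, ‖f t‖ ^ 2 ∂haarAddCircle) := by
  have h := hasSum_sq_fourierCoeff hf.toLp
  convert h using 1
  · simp [fourierCoeff_congr_ae hf.coeFn_toLp]
  · apply integral_congr_ae
    filter_upwards [hf.coeFn_toLp] with x hx
    simp [hx]

lemma memLp_cont {f : Torus → ℂ} (hf : Continuous f) (p : ℝ≥0∞) :
    MemLp f p (haarAddCircle (T := 2 * π)) := by
  obtain ⟨C, hC⟩ := isCompact_univ.exists_bound_of_continuousOn hf.continuousOn
  exact MemLp.of_bound hf.aestronglyMeasurable C (Eventually.of_forall fun x => hC x trivial)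

lemma bessel {f : Torus → ℂ} (hf : MemLp f 2 (haarAddCircle (T := 2 * π))) (K : ℕ) :
    ∑ j ∈ Finset.Icc (-(K : ℤ)) K, ‖fourierCoeff f j‖ ^ 2 ≤ ∫ t, ‖f t‖ ^ 2 ∂haarAddCircle :=
  sum_le_hasSum _ (fun _ _ => by positivity) (parseval hf)

lemma TP_parseval (K : ℕ) (a : ℤ → ℂ) :
    ∫ t, ‖TP K a t‖ ^ 2 ∂haarAddCircle = ∑ j ∈ Finset.Icc (-(K : ℤ)) K, ‖a j‖ ^ 2 := by
  have h := parseval (memLp_cont (TP_cont K a) 2)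
  refine h.unique ?_
  have : ∑ j ∈ Finset.Icc (-(K : ℤ)) K, ‖a j‖ ^ 2 =
      ∑ j ∈ Finset.Icc (-(K : ℤ)) K, ‖fourierCoeff (TP K a) j‖ ^ 2 := by
    refine Finset.sum_congr rfl fun j hj => ?_
    rw [TP_coeff, if_pos (abs_le.2 (Finset.mem_Icc.1 hj))]
  rw [this]
  apply hasSum_sum_of_ne_finset_zero
  intro j hj
  rw [TP_coeff, if_neg (fun h => hj (Finset.mem_Icc.2 (abs_le.1 h)))]
  simp

lemma norm_four (j : ℤ) (x : Torus) : ‖(fourier j x : ℂ)‖ = 1 := by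
  rw [fourier_apply]
  exact Circle.norm_coe _

lemma TP_sup (K : ℕ) (a : ℤ → ℂ) (x : Torus) :
    ‖TP K a x‖ ^ 2 ≤ (2 * K + 1) * ∑ j ∈ Finset.Icc (-(K : ℤ)) K, ‖a j‖ ^ 2 := by
  have h1 : ‖TP K a x‖ ≤ ∑ j ∈ Finset.Icc (-(K : ℤ)) K, ‖a j‖ := by
    refine (norm_sum_le _ _).trans (Finset.sum_le_sum fun j _ => ?_)
    rw [norm_mul, norm_four, mul_one]
  have h2 : ((Finset.Icc (-(K : ℤ)) K).card : ℝ) = 2 * K + 1 := by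
    have : (Finset.Icc (-(K : ℤ)) K).card = 2 * K + 1 := by
      rw [Int.card_Icc]; omega
    rw [this]; push_cast; ring
  calc ‖TP K a x‖ ^ 2 ≤ (∑ j ∈ Finset.Icc (-(K : ℤ)) K, ‖a j‖) ^ 2 := by gcongr
    _ ≤ _ := by
      rw [← h2]
      exact sq_sum_le_card_mul_sum_sq

/-- Product of trigonometric polynomials. -/
lemma TP_mul (K L : ℕ) (a b : ℤ → ℂ) : ∃ c, TP K a * TP L b = TP (K + L) c := by
  refine ⟨fun n => ∑ p ∈ (Finset.Icc (-(K : ℤ)) K ×ˢ Finset.Icc (-(L : ℤ)) L) with p.1 + p.2 = n,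
    a p.1 * b p.2, ?_⟩
  funext x
  simp only [Pi.mul_apply, TP]
  rw [Finset.sum_mul_sum, ← Finset.sum_product']
  rw [← Finset.sum_fiberwise_of_maps_to (t := Finset.Icc (-((K + L : ℕ) : ℤ)) ((K + L : ℕ) : ℤ))
    (g := fun p : ℤ × ℤ => p.1 + p.2)]
  · refine Finset.sum_congr rfl fun n _ => ?_
    rw [Finset.sum_mul]
    refine Finset.sum_congr rfl fun p hp => ?_
    rw [← (Finset.mem_filter.1 hp).2, fourier_add]
    ring
  · intro p hp
    simp only [Finset.mem_product, Finset.mem_Icc] at hp ⊢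
    push_cast
    constructor <;> linarith [hp.1.1, hp.1.2, hp.2.1, hp.2.2]

lemma TP_bernstein6 (K : ℕ) (a : ℤ → ℂ) (x : Torus) :
    ‖TP K a x‖ ^ 6 ≤ (6 * K + 1) * ∫ t, ‖TP K a t‖ ^ 6 ∂haarAddCircle := by
  obtain ⟨b, hb⟩ := TP_mul K K a a
  obtain ⟨c, hc⟩ := TP_mul (K + K) K b a
  have h3 : ∀ y, ‖TP (K + K + K) c y‖ ^ 2 = ‖TP K a y‖ ^ 6 := by
    intro y
    rw [← hc, ← hb]
    simp only [Pi.mul_apply, norm_mul]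
    ring
  have h := TP_sup (K + K + K) c x
  rw [← TP_parseval] at h
  simp_rw [h3] at h
  refine h.trans (le_of_eq ?_)
  push_cast; ring

lemma Psi1_bound (θ : ℝ) : ‖Psi1 (Complex.I * θ)‖ ≤ 4 * |θ| ^ 3 := by
  have hn : ‖Complex.I * (θ : ℂ)‖ = |θ| := by simp
  rcases le_total |θ| 1 with h | h
  · have := Complex.norm_exp_sub_sum_le_norm_mul_exp (Complex.I * θ) 3
    have e : ∑ m ∈ Finset.range 3, (Complex.I * (θ : ℂ)) ^ m / (m.factorial : ℂ) =
        1 + Complex.I * θ + (Complex.I * θ) ^ 2 / 2 := by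
      simp [Finset.sum_range_succ, Nat.factorial]
    rw [e, hn] at this
    have h3 : Real.exp |θ| ≤ 4 := by
      have := Real.exp_le_exp.2 h
      have := Real.exp_one_lt_d9
      linarith
    calc _ ≤ |θ| ^ 3 * Real.exp |θ| := this
      _ ≤ |θ| ^ 3 * 4 := by gcongr
      _ = _ := by ring
  · have h1 : ‖Complex.exp (Complex.I * θ)‖ = 1 := by
      rw [mul_comm]; exact Complex.norm_exp_ofReal_mul_I θ
    have : ‖Psi1 (Complex.I * θ)‖ ≤ 1 + (1 + |θ| + |θ| ^ 2 / 2) := by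
      unfold Psi1
      refine (norm_sub_le _ _).trans ?_
      rw [h1]
      gcongr
      refine (norm_add_le _ _).trans ?_
      gcongr
      · refine (norm_add_le _ _).trans ?_
        simp
      · simp
    have h2 : |θ| ≤ |θ| ^ 3 := le_self_pow₀ h (by norm_num)
    have h3 : |θ| ^ 2 ≤ |θ| ^ 3 := pow_le_pow_right₀ h (by norm_num)
    nlinarith

/-! Young inequality -/

lemma jensen6 {α : Type*} [MeasurableSpace α] (μ : Measure α) (w h : α → ℝ≥0∞)
    (hw : Measurable w) (hh : Measurable h) :
    (∫⁻ y, w y * h y ∂μ) ^ 6 ≤ (∫⁻ y, w y ∂μ) ^ 5 * ∫⁻ y, w y * h y ^ 6 ∂μ := by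
  have H := ENNReal.lintegral_mul_norm_pow_le (μ := μ) (f := w) (g := fun y => w y * h y ^ 6)
    hw.aemeasurable (by fun_prop) (p := 5 / 6) (q := 1 / 6) (by norm_num) (by norm_num) (by norm_num)
  have e : ∀ y, w y ^ (5 / 6 : ℝ) * (w y * h y ^ 6) ^ (1 / 6 : ℝ) = w y * h y := by
    intro y
    rw [ENNReal.mul_rpow_of_nonneg _ _ (by norm_num), ← mul_assoc,
      ← ENNReal.rpow_add_of_nonneg _ _ (by norm_num) (by norm_num), ← ENNReal.rpow_natCast,
      ← ENNReal.rpow_mul]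
    norm_num
  simp_rw [e] at H
  calc (∫⁻ y, w y * h y ∂μ) ^ 6 ≤ ((∫⁻ y, w y ∂μ) ^ (5 / 6 : ℝ) *
        (∫⁻ y, w y * h y ^ 6 ∂μ) ^ (1 / 6 : ℝ)) ^ 6 := by gcongr
    _ = _ := by
      rw [mul_pow, ← ENNReal.rpow_natCast, ← ENNReal.rpow_natCast, ← ENNReal.rpow_mul,
        ← ENNReal.rpow_mul, ← ENNReal.rpow_natCast]
      norm_num

lemma conv_TP (K : ℕ) (a b : ℤ → ℂ) (x : Torus) :
    TP K (fun j => a j * b j) x = ∫ y, TP K a y * TP K b (x - y) ∂haarAddCircle := by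
  have h : ∀ y, TP K a y * TP K b (x - y) = ∑ j ∈ Finset.Icc (-(K : ℤ)) K,
      (b j * fourier j x) * (fourier (-j) y * TP K a y) := by
    intro y
    unfold TP
    rw [mul_comm, Finset.sum_mul]
    refine Finset.sum_congr rfl fun j _ => ?_
    have : (fourier j (x - y) : ℂ) = fourier j x * fourier (-j) y := by
      rw [sub_eq_add_neg]
      simp only [fourier_apply, smul_add, smul_neg, AddCircle.toCircle_add, neg_smul]
      push_cast
      rfl
    rw [this]; ring
  simp_rw [h]
  rw [integral_finsetSum]
  · refine Finset.sum_congr rfl fun j hj => ?_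
    rw [integral_const_mul]
    have := TP_coeff K a j
    rw [if_pos (abs_le.2 (Finset.mem_Icc.1 hj))] at this
    unfold fourierCoeff at this
    simp only [smul_eq_mul] at this
    rw [this]; ring
  · intro j _
    have := TP_cont K a
    exact int_haar (by fun_prop)

lemma young6 (K : ℕ) (a b : ℤ → ℂ) :
    ∫⁻ x, ‖TP K (fun j => a j * b j) x‖ₑ ^ 6 ∂haarAddCircle ≤
      (∫⁻ y, ‖TP K a y‖ₑ ∂haarAddCircle) ^ 6 * ∫⁻ x, ‖TP K b x‖ₑ ^ 6 ∂haarAddCircle := by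
  have ha := TP_cont K a
  have hb := TP_cont K b
  have hm : Measurable (Function.uncurry fun x y => ‖TP K a y‖ₑ * ‖TP K b (x - y)‖ₑ ^ 6) :=
    ((ha.comp continuous_snd).measurable.enorm).mul
      ((hb.comp (continuous_fst.sub continuous_snd)).measurable.enorm.pow_const 6)
  set A := ∫⁻ y, ‖TP K a y‖ₑ ∂haarAddCircle with hA
  have h1 : ∀ x, ‖TP K (fun j => a j * b j) x‖ₑ ^ 6 ≤
      A ^ 5 * ∫⁻ y, ‖TP K a y‖ₑ * ‖TP K b (x - y)‖ₑ ^ 6 ∂haarAddCircle := by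
    intro x
    refine le_trans ?_ (jensen6 _ _ _ (by fun_prop)
      (hb.comp (continuous_const.sub continuous_id)).measurable.enorm)
    gcongr
    rw [conv_TP]
    refine (enorm_integral_le_lintegral_enorm _).trans (le_of_eq ?_)
    simp_rw [enorm_mul]
  calc _ ≤ ∫⁻ x, A ^ 5 * ∫⁻ y, ‖TP K a y‖ₑ * ‖TP K b (x - y)‖ₑ ^ 6 ∂haarAddCircle ∂haarAddCircle :=
        lintegral_mono h1
    _ = A ^ 5 * ∫⁻ x, ∫⁻ y, ‖TP K a y‖ₑ * ‖TP K b (x - y)‖ₑ ^ 6 ∂haarAddCircle ∂haarAddCircle := by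
        rw [lintegral_const_mul]
        exact Measurable.lintegral_prod_right hm
    _ = A ^ 5 * ∫⁻ y, ∫⁻ x, ‖TP K a y‖ₑ * ‖TP K b (x - y)‖ₑ ^ 6 ∂haarAddCircle ∂haarAddCircle := by
        rw [lintegral_lintegral_swap]
        exact hm.aemeasurable
    _ = A ^ 5 * ∫⁻ y, ‖TP K a y‖ₑ * ∫⁻ x, ‖TP K b x‖ₑ ^ 6 ∂haarAddCircle ∂haarAddCircle := by
        congr 1
        refine lintegral_congr fun y => ?_
        have hmy : Measurable fun x : Torus => ‖TP K b (x - y)‖ₑ ^ 6 :=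
          (hb.comp (continuous_id.sub continuous_const)).measurable.enorm.pow_const 6
        rw [lintegral_const_mul _ hmy,
          lintegral_sub_right_eq_self (fun x => ‖TP K b x‖ₑ ^ 6) y]
    _ = _ := by
        rw [lintegral_mul_const _ (by fun_prop), ← hA]
        ring

/-! Dirichlet kernel -/

lemma sum_Icc_succ (K : ℕ) (F : ℤ → ℂ) :
    ∑ j ∈ Finset.Icc (-((K + 1 : ℕ) : ℤ)) ((K + 1 : ℕ) : ℤ), F j =
      ∑ j ∈ Finset.Icc (-(K : ℤ)) K, F j + F (K + 1) + F (-(K + 1)) := by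
  have : Finset.Icc (-((K + 1 : ℕ) : ℤ)) ((K + 1 : ℕ) : ℤ) =
      insert (-((K : ℤ) + 1)) (insert ((K : ℤ) + 1) (Finset.Icc (-(K : ℤ)) K)) := by
    ext j; simp only [Finset.mem_insert, Finset.mem_Icc]; push_cast; omega
  rw [this, Finset.sum_insert, Finset.sum_insert]
  · ring
  · simp
  · simp; omega

lemma abel_summation (α : ℕ → ℂ) (K : ℕ) (x : Torus) :
    TP K (fun j => α j.natAbs) x = α K * TP K (fun _ => 1) x +
      ∑ k ∈ Finset.range K, (α k - α (k + 1)) * TP k (fun _ => 1) x := by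
  induction K with
  | zero => simp [TP]
  | succ K ih =>
    rw [Finset.sum_range_succ]
    unfold TP at ih ⊢
    rw [sum_Icc_succ, sum_Icc_succ, ih]
    have h1 : ((K : ℤ) + 1).natAbs = K + 1 := by omega
    have h2 : (-((K : ℤ) + 1)).natAbs = K + 1 := by omega
    beta_reduce
    rw [h1, h2]
    ring

lemma dirichlet_mul (K : ℕ) (x : Torus) :
    TP K (fun _ => 1) x * (fourier 1 x - 1) = fourier (K + 1) x - fourier (-K) x := by
  induction K with
  | zero => simp [TP]
  | succ K ih =>
    unfold TP at ih ⊢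
    rw [sum_Icc_succ, add_mul, add_mul, ih]
    push_cast
    rw [fourier_add (m := (K : ℤ) + 1) (n := 1), show (-(K : ℤ)) = -((K : ℤ) + 1) + 1 by ring,
      fourier_add (m := -((K : ℤ) + 1)) (n := 1)]
    ring

lemma dirichlet_le (K : ℕ) (x : Torus) : ‖TP K (fun _ => 1) x‖ ≤ 2 * K + 1 := by
  have h2 : ((Finset.Icc (-(K : ℤ)) K).card : ℝ) = 2 * K + 1 := by
    have : (Finset.Icc (-(K : ℤ)) K).card = 2 * K + 1 := by
      rw [Int.card_Icc]; omega
    rw [this]; push_cast; ring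
  rw [← h2]
  unfold TP
  refine (norm_sum_le _ _).trans ?_
  simp only [one_mul, norm_four]
  simp

/-- The majorant of the Dirichlet kernels. -/
def GG (δ : ℝ) (x : Torus) : ℝ := (2 / ‖(fourier 1 x : ℂ) - 1‖) ^ (1 - δ)

lemma dirichlet_interp (δ : ℝ) (h0 : 0 < δ) (h1 : δ < 1) (K : ℕ) (x : Torus)
    (hx : (fourier 1 x : ℂ) ≠ 1) :
    ‖TP K (fun _ => 1) x‖ ≤ (2 * K + 1) ^ δ * GG δ x := by
  have hp : 0 < ‖(fourier 1 x : ℂ) - 1‖ := norm_pos_iff.2 (sub_ne_zero.2 hx)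
  have h2 : ‖TP K (fun _ => 1) x‖ ≤ 2 / ‖(fourier 1 x : ℂ) - 1‖ := by
    rw [le_div_iff₀ hp, ← norm_mul, dirichlet_mul]
    refine (norm_sub_le _ _).trans ?_
    rw [norm_four, norm_four]; norm_num
  have h3 := dirichlet_le K x
  rcases (norm_nonneg (TP K (fun _ => 1) x)).eq_or_lt with h | h
  · rw [← h]; unfold GG; positivity
  calc ‖TP K (fun _ => 1) x‖ = ‖TP K (fun _ => 1) x‖ ^ δ * ‖TP K (fun _ => 1) x‖ ^ (1 - δ) := by
        rw [← Real.rpow_add h]; simp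
    _ ≤ _ := by
      unfold GG
      gcongr

lemma four_one (x : ℝ) : (fourier 1 (x : Torus) : ℂ) = Complex.exp (Complex.I * x) := by
  rw [fourier_coe_apply]
  congr 1
  have : (π : ℂ) ≠ 0 := by exact_mod_cast Real.pi_ne_zero
  push_cast
  field_simp

lemma GG_le (δ : ℝ) (h1 : δ < 1) (x : ℝ) (hx : |x| ≤ π) (hx0 : x ≠ 0) :
    GG δ (x : Torus) ≤ π ^ (1 - δ) * |x| ^ (-(1 - δ)) := by
  unfold GG
  rw [four_one, Complex.norm_exp_I_mul_ofReal_sub_one]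
  have hx' := abs_pos.2 hx0
  have h := Real.mul_abs_le_abs_sin (x := x / 2) (by rw [abs_div]; simp; linarith)
  rw [abs_div] at h
  have h' : 2 / π * |x| ≤ ‖2 * Real.sin (x / 2)‖ := by
    rw [Real.norm_eq_abs, abs_mul, abs_two]
    have : |(2 : ℝ)| = 2 := abs_two
    rw [this] at h
    have e : 2 / π * |x| = 2 * (2 / π * (|x| / 2)) := by ring
    rw [e]; gcongr
  have hpi := Real.pi_pos
  rw [Real.rpow_neg hx'.le, ← div_eq_mul_inv, ← Real.div_rpow hpi.le hx'.le]
  refine Real.rpow_le_rpow (by positivity) ?_ (by linarith)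
  calc 2 / ‖2 * Real.sin (x / 2)‖ ≤ 2 / (2 / π * |x|) := by gcongr
    _ = π / |x| := by field_simp

lemma GG_fin (δ : ℝ) (h0 : 0 < δ) (h1 : δ < 1) :
    ∫⁻ x, ENNReal.ofReal (GG δ x) ∂(haarAddCircle (T := 2 * π)) < ∞ := by
  have hpi := Real.pi_pos
  suffices H : ∫⁻ x : Torus, ENNReal.ofReal (GG δ x) < ∞ by
    rw [volume_eq_smul_haarAddCircle, lintegral_smul_measure, smul_eq_mul] at H
    by_contra hc
    rw [not_lt, top_le_iff] at hc
    rw [hc, ENNReal.mul_top (by simp [hpi])] at H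
    exact lt_irrefl _ H
  rw [← AddCircle.lintegral_preimage (2 * π) (-π)]
  have hint : IntegrableOn (fun x : ℝ => |x| ^ (-(1 - δ))) (Ioc (-π) (-π + 2 * π)) := by
    have i1 : IntervalIntegrable (fun x : ℝ => |x| ^ (-(1 - δ))) volume 0 π := by
      refine (intervalIntegral.intervalIntegrable_rpow' (r := -(1 - δ)) (by linarith)).congr ?_
      intro x hx
      rw [uIoc_of_le hpi.le] at hx
      simp [abs_of_pos hx.1]
    have i2 : IntervalIntegrable (fun x : ℝ => |x| ^ (-(1 - δ))) volume (-π) 0 := by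
      have := (IntervalIntegrable.iff_comp_neg).1 i1
      simpa using this.symm
    have := i2.trans i1
    rw [intervalIntegrable_iff_integrableOn_Ioc_of_le (by linarith)] at this
    rwa [show -π + 2 * π = π by ring]
  have hint2 := (hint.const_mul (π ^ (1 - δ))).lintegral_lt_top
  refine lt_of_le_of_lt (lintegral_mono_ae ?_) hint2
  have hne : ∀ᵐ x : ℝ, x ≠ 0 := by simp [ae_iff]
  filter_upwards [ae_restrict_of_ae hne, ae_restrict_mem measurableSet_Ioc] with x hx0 hx
  refine ENNReal.ofReal_le_ofReal (GG_le δ h1 x (abs_le.2 ⟨hx.1.le, by linarith [hx.2]⟩) hx0)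

lemma ae_ne_one : ∀ᵐ x ∂(haarAddCircle (T := 2 * π)), (fourier 1 x : ℂ) ≠ 1 := by
  have hpi := Real.pi_pos
  suffices H : ∀ᵐ x : Torus, (fourier 1 x : ℂ) ≠ 1 by
    rw [volume_eq_smul_haarAddCircle] at H
    rwa [Measure.ae_ennreal_smul_measure_iff (by simp [hpi])] at H
  rw [← (AddCircle.measurePreserving_mk (2 * π) (-π)).map_eq]
  rw [ae_map_iff (by fun_prop) ?_]
  · have hne : ∀ᵐ x : ℝ, x ≠ 0 := by simp [ae_iff]
    filter_upwards [ae_restrict_of_ae hne, ae_restrict_mem measurableSet_Ioc] with x hx0 hx h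
    rw [four_one] at h
    have h2 : ‖Complex.exp (Complex.I * x) - 1‖ = 0 := by rw [h]; simp
    rw [Complex.norm_exp_I_mul_ofReal_sub_one] at h2
    have h3 := Real.mul_abs_le_abs_sin (x := x / 2) (by
      rw [abs_div, abs_two]; have := abs_le.2 ⟨hx.1.le, (by linarith [hx.2] : x ≤ π)⟩; linarith)
    have h4 : Real.sin (x / 2) = 0 := by simpa using h2
    rw [h4] at h3
    have : 0 < 2 / π * |x / 2| := by positivity
    simp at h3
    linarith
  · exact measurableSet_eq_fun (by fun_prop) (by fun_prop) |>.compl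

/-- The symbol of the combined multiplier. -/
def alp (s τ : ℝ) (k : ℕ) : ℂ :=
  Complex.exp (Complex.I * ((τ / 2 * (k : ℝ) ^ 2 : ℝ) : ℂ)) *
    (((1 + (k : ℝ) ^ 2) ^ (-(s / 2)) : ℝ) : ℂ)

lemma alp_bounds (s : ℝ) (hs : 0 < s) (δ : ℝ) (hδ : δ ≤ s / 2) (τ : ℝ) (hτ : 0 < τ)
    (K : ℕ) (hK : τ * (K : ℝ) ^ 2 ≤ 1) :
    ‖alp s τ K‖ * (2 * K + 1) ^ δ +
      ∑ k ∈ Finset.range K, ‖alp s τ k - alp s τ (k + 1)‖ * (2 * (k : ℝ) + 1) ^ δ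
      ≤ 4 * 5 ^ (s / 4) := by
  set E : ℝ := 5 ^ (s / 4) with hE
  have hE0 : 0 < E := by positivity
  set q : ℕ → ℝ := fun k => (1 + (k : ℝ) ^ 2) ^ (-(s / 4)) with hq
  have hq0 : ∀ k, 0 < q k := fun k => by simp only [hq]; positivity
  have hqanti : ∀ k, q (k + 1) ≤ q k := by
    intro k
    simp only [hq]
    apply Real.rpow_le_rpow_of_nonpos (by positivity) _ (by linarith)
    push_cast
    gcongr
    linarith
  have hq1 : ∀ k, q k ≤ 1 := by
    intro k
    exact Real.rpow_le_one_of_one_le_of_nonpos (by nlinarith [sq_nonneg (k : ℝ)]) (by linarith)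
  have hb : ∀ k : ℕ, (1 + (k : ℝ) ^ 2) ^ (-(s / 2)) = q k ^ 2 := by
    intro k
    simp only [hq]
    rw [← Real.rpow_natCast ((1 + (k : ℝ) ^ 2) ^ (-(s / 4))) 2, ← Real.rpow_mul (by positivity)]
    congr 1; push_cast; ring
  have hd : ∀ k : ℕ, (2 * (k : ℝ) + 1) ^ δ * q k ≤ E := by
    intro k
    have hk : (0 : ℝ) ≤ k := by positivity
    calc (2 * (k : ℝ) + 1) ^ δ * q k ≤ (2 * (k : ℝ) + 1) ^ (s / 2) * q k := by
          have := (hq0 k).le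
          gcongr
          linarith
      _ = ((2 * (k : ℝ) + 1) ^ 2) ^ (s / 4) * q k := by
          rw [← Real.rpow_natCast (2 * (k : ℝ) + 1) 2, ← Real.rpow_mul (by positivity)]
          congr 2; push_cast; ring
      _ ≤ (5 * (1 + (k : ℝ) ^ 2)) ^ (s / 4) * q k := by
          have := (hq0 k).le
          gcongr
          nlinarith [sq_nonneg ((k : ℝ) - 2)]
      _ = E := by
          rw [Real.mul_rpow (by norm_num) (by positivity), mul_assoc]
          simp only [hq]
          rw [← Real.rpow_add (by positivity)]
          simp [hE]
  have hn : ∀ k, ‖alp s τ k‖ = q k ^ 2 := by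
    intro k
    unfold alp
    rw [norm_mul, mul_comm Complex.I, Complex.norm_exp_ofReal_mul_I, hb, one_mul, Complex.norm_real,
      Real.norm_of_nonneg (by positivity)]
  have hdiff : ∀ k : ℕ, ‖alp s τ k - alp s τ (k + 1)‖ ≤
      (q k ^ 2 - q (k + 1) ^ 2) + q (k + 1) ^ 2 * (τ * (2 * k + 1) / 2) := by
    intro k
    unfold alp
    rw [hb, hb]
    set θ : ℝ := τ / 2 * (k : ℝ) ^ 2
    set θ' : ℝ := τ / 2 * ((k + 1 : ℕ) : ℝ) ^ 2
    have hθ : θ' - θ = τ * (2 * k + 1) / 2 := by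
      simp only [θ, θ']; push_cast; ring
    have e : Complex.exp (Complex.I * θ) * ((q k ^ 2 : ℝ) : ℂ) -
        Complex.exp (Complex.I * θ') * ((q (k + 1) ^ 2 : ℝ) : ℂ) =
        Complex.exp (Complex.I * θ) * ((q k ^ 2 - q (k + 1) ^ 2 : ℝ) : ℂ) -
        Complex.exp (Complex.I * θ) * ((q (k + 1) ^ 2 : ℝ) : ℂ) *
          (Complex.exp (Complex.I * ((θ' - θ : ℝ) : ℂ)) - 1) := by
      have : Complex.exp (Complex.I * θ') =
          Complex.exp (Complex.I * θ) * Complex.exp (Complex.I * ((θ' - θ : ℝ) : ℂ)) := by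
        rw [← Complex.exp_add]; congr 1; push_cast; ring
      rw [this]; push_cast; ring
    have h1 : ‖Complex.exp (Complex.I * θ)‖ = 1 := by
      rw [mul_comm]; exact Complex.norm_exp_ofReal_mul_I θ
    rw [e]
    refine (norm_sub_le _ _).trans ?_
    rw [norm_mul, norm_mul, norm_mul, h1, one_mul, one_mul, Complex.norm_real, Complex.norm_real]
    have h2 : 0 ≤ q k ^ 2 - q (k + 1) ^ 2 := by
      have := hqanti k
      have := hq0 (k + 1)
      nlinarith
    rw [Real.norm_of_nonneg h2, Real.norm_of_nonneg (by positivity)]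
    gcongr
    refine Real.norm_exp_I_mul_ofReal_sub_one_le.trans ?_
    rw [hθ, Real.norm_of_nonneg (by positivity)]
  have hsum : ∀ K : ℕ, ∑ k ∈ Finset.range K, ‖alp s τ k - alp s τ (k + 1)‖ * (2 * (k : ℝ) + 1) ^ δ
      ≤ E * (2 * (1 - q K) + τ * (K : ℝ) ^ 2 / 2) := by
    intro K
    induction K with
    | zero => simp [hq]
    | succ K ih =>
      rw [Finset.sum_range_succ]
      have hstep : ‖alp s τ K - alp s τ (K + 1)‖ * (2 * (K : ℝ) + 1) ^ δ ≤
          2 * E * (q K - q (K + 1)) + E * (τ * (2 * K + 1) / 2) := by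
        set d := (2 * (K : ℝ) + 1) ^ δ with hdd
        have hd0 : 0 ≤ d := by positivity
        have hdK : d * q K ≤ E := hd K
        have a1 := hqanti K
        have a2 := hq0 (K + 1)
        have a3 := hq0 K
        have a4 := hq1 K
        have t0 : 0 ≤ τ * (2 * (K : ℝ) + 1) / 2 := by positivity
        calc _ ≤ ((q K ^ 2 - q (K + 1) ^ 2) + q (K + 1) ^ 2 * (τ * (2 * K + 1) / 2)) * d := by
              gcongr; exact hdiff K
          _ = (q K - q (K + 1)) * (d * (q K + q (K + 1))) +
                (d * q (K + 1) ^ 2) * (τ * (2 * K + 1) / 2) := by ring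
          _ ≤ (q K - q (K + 1)) * (2 * E) + E * (τ * (2 * K + 1) / 2) := by
              have b1 : d * (q K + q (K + 1)) ≤ 2 * E := by
                have : d * q (K + 1) ≤ d * q K := by gcongr
                linarith
              have b2 : d * q (K + 1) ^ 2 ≤ E := by
                have : q (K + 1) ^ 2 ≤ q K := by nlinarith
                have : d * q (K + 1) ^ 2 ≤ d * q K := by gcongr
                linarith
              have b3 : 0 ≤ q K - q (K + 1) := by linarith
              gcongr
          _ = _ := by ring
      push_cast
      nlinarith
  have hfin := hsum K
  have hlast : ‖alp s τ K‖ * (2 * (K : ℝ) + 1) ^ δ ≤ E * q K := by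
    rw [hn]
    have := hd K
    have := (hq0 K).le
    calc q K ^ 2 * (2 * (K : ℝ) + 1) ^ δ = ((2 * (K : ℝ) + 1) ^ δ * q K) * q K := by ring
      _ ≤ _ := by gcongr
  have := hq0 K
  have := hq1 K
  nlinarith

lemma kernel_bound (s : ℝ) (hs : 0 < s) (δ : ℝ) (h0 : 0 < δ) (h1 : δ < 1) (hδ : δ ≤ s / 2)
    (τ : ℝ) (hτ : 0 < τ) (K : ℕ) (hK : τ * (K : ℝ) ^ 2 ≤ 1) (x : Torus)
    (hx : (fourier 1 x : ℂ) ≠ 1) :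
    ‖TP K (fun j => alp s τ j.natAbs) x‖ ≤ 4 * 5 ^ (s / 4) * GG δ x := by
  rw [abel_summation]
  have hG : 0 ≤ GG δ x := by unfold GG; positivity
  refine (norm_add_le _ _).trans ?_
  calc _ ≤ ‖alp s τ K‖ * ((2 * K + 1) ^ δ * GG δ x) +
      ∑ k ∈ Finset.range K, ‖alp s τ k - alp s τ (k + 1)‖ * ((2 * (k : ℝ) + 1) ^ δ * GG δ x) := by
        rw [norm_mul]
        gcongr
        · exact dirichlet_interp δ h0 h1 K x hx
        · refine (norm_sum_le _ _).trans (Finset.sum_le_sum fun k _ => ?_)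
          rw [norm_mul]
          gcongr
          exact dirichlet_interp δ h0 h1 k x hx
    _ = (‖alp s τ K‖ * (2 * K + 1) ^ δ +
      ∑ k ∈ Finset.range K, ‖alp s τ k - alp s τ (k + 1)‖ * (2 * (k : ℝ) + 1) ^ δ) * GG δ x := by
        rw [add_mul, Finset.sum_mul]
        simp only [mul_assoc]
    _ ≤ _ := by
        gcongr
        exact alp_bounds s hs δ hδ τ hτ K hK

lemma lint6 {f : Torus → ℂ} (hf : Continuous f) :
    ∫⁻ x, ‖f x‖ₑ ^ 6 ∂haarAddCircle = ENNReal.ofReal (∫ x, ‖f x‖ ^ 6 ∂haarAddCircle) := by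
  rw [ofReal_integral_eq_lintegral_ofReal (int_haarR (by fun_prop))
    (Eventually.of_forall fun x => by positivity)]
  refine lintegral_congr fun x => ?_
  rw [ENNReal.ofReal_pow (norm_nonneg _), ofReal_norm]

lemma L6_bound (s : ℝ) (hs : 0 < s) : ∃ B : ℝ, 0 ≤ B ∧ ∀ (τ : ℝ) (K : ℕ) (c : ℤ → ℂ), 0 < τ →
    τ * (K : ℝ) ^ 2 ≤ 1 →
    ∫ x, ‖linProp (τ / 2) (TP K c) x‖ ^ 6 ∂haarAddCircle ≤
      B * ∫ x, ‖Jop s (TP K c) x‖ ^ 6 ∂haarAddCircle := by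
  obtain ⟨δ, h0, h1, hδ⟩ : ∃ δ : ℝ, 0 < δ ∧ δ < 1 ∧ δ ≤ s / 2 :=
    ⟨min (s / 2) (1 / 2), by positivity, (min_le_right _ _).trans_lt (by norm_num), min_le_left _ _⟩
  set G := ∫⁻ x, ENNReal.ofReal (4 * 5 ^ (s / 4) * GG δ x) ∂(haarAddCircle (T := 2 * π)) with hGdef
  have hG : G < ∞ := by
    have : G = ENNReal.ofReal (4 * 5 ^ (s / 4)) *
        ∫⁻ x, ENNReal.ofReal (GG δ x) ∂(haarAddCircle (T := 2 * π)) := by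
      rw [hGdef, ← lintegral_const_mul' _ _ ENNReal.ofReal_ne_top]
      refine lintegral_congr fun x => ?_
      rw [ENNReal.ofReal_mul (by positivity)]
    rw [this]
    exact ENNReal.mul_lt_top ENNReal.ofReal_lt_top (GG_fin δ h0 h1)
  refine ⟨G.toReal ^ 6, by positivity, fun τ K c hτ hK => ?_⟩
  have hl : linProp (τ / 2) (TP K c) =
      TP K (fun j => alp s τ j.natAbs * ((((1 + (j : ℝ) ^ 2) ^ (s / 2) : ℝ) : ℂ) * c j)) := by
    unfold linProp
    rw [mult_TP]
    congr 1
    funext j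
    unfold alp
    have hj : ((j.natAbs : ℝ)) ^ 2 = (j : ℝ) ^ 2 := by
      have : (j.natAbs : ℝ) = |(j : ℝ)| := by
        rw [Nat.cast_natAbs]; push_cast; rfl
      rw [this, sq_abs]
    rw [hj]
    have e1 : ((((1 + (j : ℝ) ^ 2) ^ (-(s / 2)) : ℝ) : ℂ)) * (((1 + (j : ℝ) ^ 2) ^ (s / 2) : ℝ) : ℂ)
        = 1 := by
      rw [← Complex.ofReal_mul, ← Real.rpow_add (by positivity)]; simp
    have e2 : Complex.I * ((τ / 2 * (j : ℝ) ^ 2 : ℝ) : ℂ) =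
        Complex.I * ((τ / 2 : ℝ) : ℂ) * (j : ℂ) ^ 2 := by push_cast; ring
    rw [e2]
    linear_combination (-(Complex.exp (Complex.I * ((τ / 2 : ℝ) : ℂ) * (j : ℂ) ^ 2) * c j)) * e1
  have hJ : Jop s (TP K c) = TP K (fun j => (((1 + (j : ℝ) ^ 2) ^ (s / 2) : ℝ) : ℂ) * c j) := by
    unfold Jop
    rw [mult_TP]
  rw [hl, hJ]
  have hY := young6 K (fun j => alp s τ j.natAbs)
    (fun j => (((1 + (j : ℝ) ^ 2) ^ (s / 2) : ℝ) : ℂ) * c j)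
  have hker : ∫⁻ y, ‖TP K (fun j => alp s τ j.natAbs) y‖ₑ ∂haarAddCircle ≤ G := by
    refine lintegral_mono_ae ?_
    filter_upwards [ae_ne_one] with x hx
    rw [← ofReal_norm]
    exact ENNReal.ofReal_le_ofReal (kernel_bound s hs δ h0 h1 hδ τ hτ K hK x hx)
  have hY2 := hY.trans (mul_le_mul_left (pow_le_pow_left' hker 6) _)
  rw [lint6 (TP_cont _ _), lint6 (TP_cont _ _), ← ENNReal.ofReal_toReal hG.ne,
    ← ENNReal.ofReal_pow (by positivity), ← ENNReal.ofReal_mul (by positivity)] at hY2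
  refine (ENNReal.ofReal_le_ofReal_iff ?_).1 hY2
  have : 0 ≤ ∫ x, ‖TP K (fun j => (((1 + (j : ℝ) ^ 2) ^ (s / 2) : ℝ) : ℂ) * c j) x‖ ^ 6
    ∂haarAddCircle := integral_nonneg fun x => by positivity
  positivity

lemma norm_conv {f : Torus → ℂ} (hf : MemLp f 2 (haarAddCircle (T := 2 * π))) :
    (eLpNorm f 2 volume).toReal ^ 2 = 2 * π * ∫ x, ‖f x‖ ^ 2 ∂haarAddCircle := by
  have hpi := Real.pi_pos
  rw [integral_haarAddCircle]
  have hf2 : MemLp f 2 volume := (memLp_haarAddCircle_iff).1 hf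
  rw [hf2.eLpNorm_eq_integral_rpow_norm (by norm_num) (by norm_num)]
  have h0 : 0 ≤ ∫ x, ‖f x‖ ^ 2 := integral_nonneg fun x => by positivity
  have e : ∫ x, ‖f x‖ ^ (2 : ℝ≥0∞).toReal = ∫ x, ‖f x‖ ^ 2 := by
    simp
  rw [e, ENNReal.toReal_ofReal (by positivity), ← Real.rpow_natCast, ← Real.rpow_mul h0]
  simp only [smul_eq_mul]
  field_simp
  simp

lemma norm_conv6 {f : Torus → ℂ} (hf : Continuous f) :
    (eLpNorm f 6 volume).toReal ^ 6 = 2 * π * ∫ x, ‖f x‖ ^ 6 ∂haarAddCircle := by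
  have hpi := Real.pi_pos
  rw [integral_haarAddCircle]
  have hf2 : MemLp f 6 volume := (memLp_haarAddCircle_iff).1 (memLp_cont hf 6)
  rw [hf2.eLpNorm_eq_integral_rpow_norm (by norm_num) (by norm_num)]
  have h0 : 0 ≤ ∫ x, ‖f x‖ ^ 6 := integral_nonneg fun x => by positivity
  have e : ∫ x, ‖f x‖ ^ (6 : ℝ≥0∞).toReal = ∫ x, ‖f x‖ ^ 6 := by
    refine integral_congr_ae (Eventually.of_forall fun x => ?_)
    simp only [ENNReal.toReal_ofNat]
    exact_mod_cast Real.rpow_natCast _ 6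
  rw [e, ENNReal.toReal_ofReal (by positivity), ← Real.rpow_natCast, ← Real.rpow_mul h0]
  simp only [smul_eq_mul]
  field_simp
  simp

lemma coeff_bound {f : Torus → ℂ} {M : ℝ} (hM : 0 < M)
    (hf : eLpNorm f 2 volume ≤ ENNReal.ofReal M) (K : ℕ) :
    ∑ j ∈ Finset.Icc (-(K : ℤ)) K, ‖fourierCoeff f j‖ ^ 2 ≤ M ^ 2 := by
  have hpi := Real.pi_gt_three
  by_cases hm : AEStronglyMeasurable f (haarAddCircle (T := 2 * π))
  · have hmv : AEStronglyMeasurable f (volume : Measure Torus) := by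
      rw [volume_eq_smul_haarAddCircle]; exact hm.smul_measure _
    have h2 : MemLp f 2 (haarAddCircle (T := 2 * π)) :=
      (memLp_haarAddCircle_iff).2 ⟨hmv, hf.trans_lt ENNReal.ofReal_lt_top⟩
    refine (bessel h2 K).trans ?_
    have h3 := norm_conv h2
    have h4 : (eLpNorm f 2 volume).toReal ≤ M := ENNReal.toReal_le_of_le_ofReal hM.le hf
    have h5 : (eLpNorm f 2 volume).toReal ^ 2 ≤ M ^ 2 := by gcongr
    have h0 : 0 ≤ ∫ x, ‖f x‖ ^ 2 ∂haarAddCircle := integral_nonneg fun x => by positivity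
    nlinarith
  · have : ∀ j, fourierCoeff f j = 0 := by
      intro j
      unfold fourierCoeff
      apply integral_undef
      intro hi
      apply hm
      have h1 : AEStronglyMeasurable (fun t : Torus => (fourier j t : ℂ) * (fourier (-j) t • f t))
          haarAddCircle := by
        refine AEStronglyMeasurable.mul ?_ hi.aestronglyMeasurable
        exact (by fun_prop : Continuous fun t : Torus => (fourier j t : ℂ)).aestronglyMeasurable
      convert h1 using 1
      funext t
      rw [smul_eq_mul, ← mul_assoc, ← fourier_add]
      simp
    simp [this]
    positivity

set_option maxHeartbeats 1600000 in
lemma step (lam : ℝ) (hlam : lam = 1 ∨ lam = -1) (M : ℝ) (hM : 0 < M) (τ N t : ℝ) (hτ : 0 < τ)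
    (hN : 1 ≤ N) (f : Torus → ℂ) (hf : eLpNorm f 2 volume ≤ ENNReal.ofReal M) :
    (eLpNorm (R6 lam τ N t (PiLe N f)) 2 volume).toReal ≤
      49 * M * τ ^ 3 * N * ∫ x, ‖linProp (τ / 2) (PiLe N f) x‖ ^ 6 ∂haarAddCircle := by
  set K := ⌊N⌋₊ with hKdef
  have hKN : (K : ℝ) ≤ N := Nat.floor_le (by linarith)
  have hP := PiLe_eq N hN f
  obtain ⟨a, ha, hac⟩ : ∃ a, linProp (τ / 2) (PiLe N f) = TP K a ∧
      ∑ j ∈ Finset.Icc (-(K : ℤ)) K, ‖a j‖ ^ 2 ≤ M ^ 2 := by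
    refine ⟨fun j => Complex.exp (Complex.I * (τ / 2 : ℝ) * (j : ℂ) ^ 2) * fourierCoeff f j, ?_, ?_⟩
    · rw [hP]; exact mult_TP _ _ _
    · refine le_trans (le_of_eq ?_) (coeff_bound hM hf K)
      refine Finset.sum_congr rfl fun j _ => ?_
      rw [norm_mul, show Complex.I * ((τ / 2 : ℝ) : ℂ) * (j : ℂ) ^ 2 =
        ((τ / 2 * (j : ℝ) ^ 2 : ℝ) : ℂ) * Complex.I by push_cast; ring,
        Complex.norm_exp_ofReal_mul_I, one_mul]
  set w : Torus → ℂ := fun y =>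
      Psi1 (-Complex.I * lam * τ * ((‖TP K a y‖ ^ 2 : ℝ) : ℂ)) * TP K a y with hw
  have hc := TP_cont K a
  have hwc : Continuous w := by
    simp only [hw]
    unfold Psi1
    fun_prop
  have hR : R6 lam τ N t (PiLe N f) = TP K (fun j =>
      -(Complex.exp (Complex.I * (-t : ℝ) * (j : ℂ) ^ 2) *
        (Complex.exp (Complex.I * (τ / 2 : ℝ) * (j : ℂ) ^ 2) * fourierCoeff w j))) := by
    unfold R6
    rw [ha, ← hw, PiLe_eq N hN w]
    unfold linProp
    rw [mult_TP, mult_TP]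
    funext x
    simp only [TP, ← hKdef]
    rw [← Finset.sum_neg_distrib]
    refine Finset.sum_congr rfl fun j _ => ?_
    ring
  rw [ha]
  set I6 := ∫ x, ‖TP K a x‖ ^ 6 ∂haarAddCircle with hI
  have hI0 : 0 ≤ I6 := integral_nonneg fun x => by positivity
  clear_value I6
  have hn : (eLpNorm (R6 lam τ N t (PiLe N f)) 2 volume).toReal ^ 2 ≤
      2 * π * ∫ x, ‖w x‖ ^ 2 ∂haarAddCircle := by
    rw [hR, norm_conv (memLp_cont (TP_cont _ _) 2), TP_parseval]
    refine mul_le_mul_of_nonneg_left (le_trans (le_of_eq ?_) (bessel (memLp_cont hwc 2) K))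
      (by positivity)
    refine Finset.sum_congr rfl fun j _ => ?_
    rw [norm_neg, norm_mul, norm_mul, show Complex.I * ((τ / 2 : ℝ) : ℂ) * (j : ℂ) ^ 2 =
        ((τ / 2 * (j : ℝ) ^ 2 : ℝ) : ℂ) * Complex.I by push_cast; ring,
        show Complex.I * ((-t : ℝ) : ℂ) * (j : ℂ) ^ 2 =
        ((-t * (j : ℝ) ^ 2 : ℝ) : ℂ) * Complex.I by push_cast; ring,
        Complex.norm_exp_ofReal_mul_I, Complex.norm_exp_ofReal_mul_I, one_mul, one_mul]
  have hpt : ∀ x, ‖w x‖ ^ 2 ≤ (16 * τ ^ 6 * (21 * N ^ 2 * M ^ 2 * I6)) * ‖TP K a x‖ ^ 6 := by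
    intro x
    have hv0 := norm_nonneg (TP K a x)
    set v := ‖TP K a x‖ with hv
    have h1 : ‖w x‖ ≤ 4 * (τ * v ^ 2) ^ 3 * v := by
      simp only [hw]
      rw [norm_mul, ← hv]
      gcongr
      rw [show -Complex.I * (lam : ℂ) * (τ : ℂ) * ((v ^ 2 : ℝ) : ℂ) =
        Complex.I * ((-(lam * (τ * v ^ 2)) : ℝ) : ℂ) by push_cast; ring]
      refine (Psi1_bound _).trans (le_of_eq ?_)
      have hl : |lam| = 1 := by rcases hlam with h | h <;> simp [h]
      rw [abs_neg, abs_mul, hl, one_mul, abs_of_nonneg (by positivity)]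
    have h2 : v ^ 2 ≤ 3 * N * M ^ 2 := by
      refine (TP_sup K a x).trans ?_
      have : 0 ≤ ∑ j ∈ Finset.Icc (-(K : ℤ)) K, ‖a j‖ ^ 2 := by positivity
      gcongr
      linarith
    have h3 : v ^ 6 ≤ 7 * N * I6 := by
      have hb := TP_bernstein6 K a x
      rw [← hI, ← hv] at hb
      exact hb.trans (mul_le_mul_of_nonneg_right (by linarith) hI0)
    calc ‖w x‖ ^ 2 ≤ (4 * (τ * v ^ 2) ^ 3 * v) ^ 2 := by gcongr
      _ = 16 * τ ^ 6 * (v ^ 2 * v ^ 6) * v ^ 6 := by ring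
      _ ≤ 16 * τ ^ 6 * ((3 * N * M ^ 2) * (7 * N * I6)) * v ^ 6 := by gcongr
      _ = _ := by ring
  have hint : ∫ x, ‖w x‖ ^ 2 ∂haarAddCircle ≤ (16 * τ ^ 6 * (21 * N ^ 2 * M ^ 2 * I6)) * I6 := by
    have hm := integral_mono (int_haarR (by fun_prop)) (int_haarR (by fun_prop)) hpt
    rwa [integral_const_mul, ← hI] at hm
  refine le_of_sq_le_sq ?_ (by positivity)
  refine hn.trans ?_
  have hpi : π < 3.1416 := Real.pi_lt_d4
  calc _ ≤ 2 * 3.1416 * ((16 * τ ^ 6 * (21 * N ^ 2 * M ^ 2 * I6)) * I6) := by gcongr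
    _ = (2 * 3.1416 * 336) * (M * τ ^ 3 * N * I6) ^ 2 := by ring
    _ ≤ 2401 * (M * τ ^ 3 * N * I6) ^ 2 := by
      gcongr
      norm_num
    _ = _ := by ring

theorem R6_estimate (lam : ℝ) (hlam : lam = 1 ∨ lam = -1)
    (γ : ℝ) (hγ : 0 < γ) (M : ℝ) (hM : 0 < M)
    (ε : ℝ) (hε : ε ∈ Ioo (0 : ℝ) γ) :
    ∃ C : ℝ, 0 < C ∧
      ∀ (τ N : ℝ), 0 < τ → 1 ≤ N → τ * N ^ 2 ≤ 1 →
      ∀ (L : ℕ), 0 < L →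
      ∀ un : ℕ → Torus → ℂ,
        (∀ n : ℕ, n < L → eLpNorm (un n) 2 volume ≤ ENNReal.ofReal M) →
        (∑ n ∈ Finset.range L,
            (eLpNorm (R6 lam τ N ((n + 1) * τ) (PiLe N (un n))) 2 volume).toReal)
          ≤ C * τ ^ 2 * N * (Yquant γ ε τ N L un) ^ 6 := by
  obtain ⟨B, hB0, hB⟩ := L6_bound (γ - ε) (by linarith [hε.2])
  refine ⟨49 * M * B + 1, by positivity, ?_⟩
  intro τ N hτ hN hτN L hL un hun
  have hpi := Real.pi_gt_three
  set X : ℕ → ℝ := fun n => (eLpNorm (Jop (γ - ε) (PiLe N (un n))) 6 volume).toReal with hX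
  have hX0 : ∀ n, 0 ≤ X n := fun n => ENNReal.toReal_nonneg
  have hS0 : 0 ≤ ∑ n ∈ Finset.range L, X n ^ 6 := Finset.sum_nonneg fun n _ => by
    have := hX0 n
    positivity
  have hY : Yquant γ ε τ N L un ^ 6 = τ * ∑ n ∈ Finset.range L, X n ^ 6 := by
    unfold Yquant
    rw [mul_pow, ← Real.rpow_natCast, ← Real.rpow_natCast, ← Real.rpow_mul hτ.le,
      ← Real.rpow_mul hS0]
    norm_num
  rw [hY]
  have hKN : ((⌊N⌋₊ : ℕ) : ℝ) ≤ N := Nat.floor_le (by linarith)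
  have hK : τ * ((⌊N⌋₊ : ℕ) : ℝ) ^ 2 ≤ 1 := by
    refine le_trans ?_ hτN
    gcongr
  have hone : ∀ n ∈ Finset.range L,
      (eLpNorm (R6 lam τ N ((n + 1) * τ) (PiLe N (un n))) 2 volume).toReal ≤
        (49 * M * B + 1) * τ ^ 3 * N * X n ^ 6 := by
    intro n hn
    refine (step lam hlam M hM τ N _ hτ hN (un n) (hun n (Finset.mem_range.1 hn))).trans ?_
    have h1 := hB τ ⌊N⌋₊ (fourierCoeff (un n)) hτ hK
    rw [← PiLe_eq N hN] at h1
    have hJc : Continuous (Jop (γ - ε) (PiLe N (un n))) := by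
      rw [PiLe_eq N hN]
      unfold Jop
      rw [mult_TP]
      exact TP_cont _ _
    have h2 : X n ^ 6 = _ := norm_conv6 hJc
    have h3 : 0 ≤ ∫ x, ‖Jop (γ - ε) (PiLe N (un n)) x‖ ^ 6 ∂haarAddCircle :=
      integral_nonneg fun x => by positivity
    have h4 : ∫ x, ‖Jop (γ - ε) (PiLe N (un n)) x‖ ^ 6 ∂haarAddCircle ≤ X n ^ 6 := by
      rw [h2]; nlinarith
    have hXn := hX0 n
    calc _ ≤ 49 * M * τ ^ 3 * N * (B * X n ^ 6) := by
          gcongr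
          exact h1.trans (by gcongr)
      _ = (49 * M * B) * (τ ^ 3 * N * X n ^ 6) := by ring
      _ ≤ (49 * M * B + 1) * (τ ^ 3 * N * X n ^ 6) := by
          gcongr
          linarith
      _ = _ := by ring
  refine (Finset.sum_le_sum hone).trans (le_of_eq ?_)
  rw [← Finset.mul_sum]
  ring
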